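/- In the periodic vortex loop setting, for every initial configuration (x_α(0), m_α(0))_{α=1,…,N} there exists a unique solution (x_α(t), m_α(t))_{α=1,…,N} of the loop system ẋ_α(t) = u_t(x_α(t)), ṁ_α^i(t) = −∑_{j=1}^3 m_α^j(t) ∂_i u_t^j(x_α(t)) defined for all times t ∈ [0,∞). -/

import Mathlib

noncomputable section
open MeasureTheory Real Set

/-- Three-dimensional Euclidean space. -/
abbrev E3 := EuclideanSpace ℝ (Fin 3)

/-- `ℂ³` with the Hermitian inner product. -/
abbrev C3 := EuclideanSpace ℂ (Fin 3)

/-- A wave number `k ∈ ℤ³` viewed as a vector of `ℂ³`. -/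
def kC (k : Fin 3 → ℤ) : C3 := WithLp.toLp 2 (fun i => (k i : ℂ))

/-- A wave number `k ∈ ℤ³` viewed as a vector of `ℝ³`. -/
def kR (k : Fin 3 → ℤ) : E3 := WithLp.toLp 2 (fun i => (k i : ℝ))

/-- A real vector viewed as a vector of `ℂ³`. -/
def toC3 (m : E3) : C3 := WithLp.toLp 2 (fun i => (m i : ℂ))

/-- For `k ≠ 0`, the orthogonal projection of `ℂ³` onto the orthogonal complement
of `k`; the identity for `k = 0`. -/
def projPerp (k : Fin 3 → ℤ) (v : C3) : C3 :=
  if k = 0 then v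
  else v - ((inner ℂ (kC k) v : ℂ) / ((‖kR k‖ ^ 2 : ℝ) : ℂ)) • kC k

/-- The (complex form of the) velocity field
`u(x) = (2π)⁻³ ∑_{k∈ℤ³} ρ̂(k) Π_k (∑_α m_α e^{-i⟨k, x−x_α⟩})`. -/
def loopVelC (N : ℕ) (ρh : (Fin 3 → ℤ) → ℝ) (x m : Fin N → E3) (p : E3) : C3 :=
  ((2 * π : ℝ) ^ 3)⁻¹ •
    ∑' k : Fin 3 → ℤ, (ρh k : ℂ) •
      projPerp k (∑ α, Complex.exp (-Complex.I * ((inner ℝ (kR k) (p - x α) : ℝ) : ℂ)) • toC3 (m α))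

/-- The velocity field of the periodic vortex loop configuration `(x_α, m_α)`,
a real vector field by the symmetry of `ρ̂`. -/
def loopVel (N : ℕ) (ρh : (Fin 3 → ℤ) → ℝ) (x m : Fin N → E3) (p : E3) : E3 :=
  WithLp.toLp 2 (fun i => (loopVelC N ρh x m p i).re)

/-- The energy `H = (1/(2(2π)³)) ∑_{k∈ℤ³} ρ̂(k) |Π_k ∑_α m_α e^{i⟨k,x_α⟩}|²`. -/
def loopEnergy (N : ℕ) (ρh : (Fin 3 → ℤ) → ℝ) (x m : Fin N → E3) : ℝ :=
  (1 / (2 * (2 * π) ^ 3)) *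
    ∑' k : Fin 3 → ℤ, ρh k *
      ‖projPerp k (∑ α, Complex.exp (Complex.I * ((inner ℝ (kR k) (x α) : ℝ) : ℂ)) • toC3 (m α))‖ ^ 2

/-- `(x_α(t), m_α(t))` solves the vortex loop system
`ẋ_α = u_t(x_α)`, `ṁ_α^i = −∑_j m_α^j ∂_i u_t^j(x_α)` at every time of `S`. -/
def IsLoopSystemSolution (N : ℕ) (ρh : (Fin 3 → ℤ) → ℝ)
    (x m : Fin N → ℝ → E3) (S : Set ℝ) : Prop :=
  ∀ t ∈ S, ∀ α : Fin N,
    HasDerivAt (x α) (loopVel N ρh (fun β => x β t) (fun β => m β t) (x α t)) t ∧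
    ∀ i : Fin 3,
      HasDerivAt (fun s => m α s i)
        (-∑ j : Fin 3, m α t j *
          fderiv ℝ (loopVel N ρh (fun β => x β t) (fun β => m β t)) (x α t)
            (EuclideanSpace.single i 1) j) t

section ODE

open Metric

variable {E : Type*} [NormedAddCommGroup E] [NormedSpace ℝ E] [FiniteDimensional ℝ E]

/-- Two solutions on `[0, T)` of an autonomous `C¹` equation with equal initial value agree. -/
theorem ContDiff.eqOn_Ico_of_hasDerivAt {F : E → E} (hF : ContDiff ℝ 1 F) {T : ℝ} {y z : ℝ → E}
    (h0 : y 0 = z 0) (hy : ∀ t ∈ Ico 0 T, HasDerivAt y (F (y t)) t)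
    (hz : ∀ t ∈ Ico 0 T, HasDerivAt z (F (z t)) t) : EqOn y z (Ico 0 T) := by
  intro t ht
  have hsub : Icc 0 t ⊆ Ico 0 T := fun s hs => ⟨hs.1, hs.2.trans_lt ht.2⟩
  have hyc : ContinuousOn y (Icc 0 t) := fun s hs =>
    (hy s (hsub hs)).continuousAt.continuousWithinAt
  have hzc : ContinuousOn z (Icc 0 t) := fun s hs =>
    (hz s (hsub hs)).continuousAt.continuousWithinAt
  obtain ⟨A, hA⟩ := isCompact_Icc.exists_bound_of_continuousOn hyc
  obtain ⟨B, hB⟩ := isCompact_Icc.exists_bound_of_continuousOn hzc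
  obtain ⟨K, hK⟩ := (hF.contDiffOn (s := closedBall (0 : E) (max A B))).exists_lipschitzOnWith
    one_ne_zero (convex_closedBall _ _) (isCompact_closedBall _ _)
  refine ODE_solution_unique_of_mem_Icc_right (v := fun _ => F) (K := K)
    (s := fun _ => closedBall (0 : E) (max A B)) (fun _ _ => hK) hyc
    (fun s hs => (hy s (hsub (Ico_subset_Icc_self hs))).hasDerivWithinAt) (fun s hs => ?_) hzc
    (fun s hs => (hz s (hsub (Ico_subset_Icc_self hs))).hasDerivWithinAt) (fun s hs => ?_)
    h0 (right_mem_Icc.2 ht.1)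
  · simpa using Or.inl (hA s (Ico_subset_Icc_self hs))
  · simpa using Or.inr (hB s (Ico_subset_Icc_self hs))

/-- A compactly supported `C¹` vector field has integral curves on arbitrarily long intervals. -/
theorem ContDiff.exists_hasDerivAt_of_hasCompactSupport {G : E → E} (hG : ContDiff ℝ 1 G)
    (hc : HasCompactSupport G) (z₀ : E) {T : ℝ} (hT : 0 < T) :
    ∃ z : ℝ → E, z 0 = z₀ ∧ ∀ t ∈ Ioo (-T) T, HasDerivAt z (G (z t)) t := by
  obtain ⟨K, hK⟩ := hG.lipschitzWith_of_hasCompactSupport hc one_ne_zero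
  obtain ⟨L, hL⟩ := hc.exists_bound_of_continuous hG.continuous
  have hL0 : 0 ≤ L := (norm_nonneg _).trans (hL z₀)
  have hpl : IsPicardLindelof (fun _ => G) (tmin := -T) (tmax := T) ⟨0, by simp [hT.le]⟩ z₀
      ⟨L * T, by positivity⟩ 0 ⟨L, hL0⟩ K :=
    { lipschitzOnWith := fun _ _ => hK.lipschitzOnWith
      continuousOn := fun _ _ => continuousOn_const
      norm_le := fun _ _ x _ => hL x
      mul_max_le := show L * max (T - 0) (0 - -T) ≤ L * T - 0 by simp }
  obtain ⟨z, hz0, hz⟩ := hpl.exists_eq_forall_mem_Icc_hasDerivWithinAt₀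
  exact ⟨z, hz0, fun t ht =>
    (hz t (Ioo_subset_Icc_self ht)).hasDerivAt (Icc_mem_nhds ht.1 ht.2)⟩

/-- If a `C¹` vector field has a conserved quantity on whose level sets it grows at most linearly,
then its integral curves exist on arbitrarily long forward intervals. -/
theorem ContDiff.exists_hasDerivAt_Ico_of_conserved {F : E → E} (hF : ContDiff ℝ 1 F) {H : E → ℝ}
    (hH : Differentiable ℝ H) (hHF : ∀ z, fderiv ℝ H z (F z) = 0)
    (hgrow : ∀ h, ∃ C, 0 ≤ C ∧ ∀ z, H z = h → ‖F z‖ ≤ C * ‖z‖ + C) (z₀ : E) {T : ℝ}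
    (hT : 0 < T) :
    ∃ z : ℝ → E, z 0 = z₀ ∧ ∀ t ∈ Ico 0 T, HasDerivAt z (F (z t)) t := by
  obtain ⟨C, hC0, hC⟩ := hgrow (H z₀)
  set R := max (gronwallBound ‖z₀‖ C C T) 1 with hR
  have hRpos : 0 < R := lt_max_of_lt_right one_pos
  let χ : ContDiffBump (0 : E) := ⟨R, R + 1, hRpos, lt_add_one R⟩
  obtain ⟨z, hz0, hz⟩ := (χ.contDiff.smul hF).exists_hasDerivAt_of_hasCompactSupport
    χ.hasCompactSupport.smul_right z₀ hT
  have hder : ∀ t ∈ Ico 0 T, HasDerivAt z (χ (z t) • F (z t)) t := fun t ht =>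
    hz t ⟨by linarith [ht.1], ht.2⟩
  have hbound : ∀ t ∈ Ico 0 T, ‖z t‖ ≤ R := by
    intro t ht
    have hsub : Icc 0 t ⊆ Ico 0 T := fun s hs => ⟨hs.1, hs.2.trans_lt ht.2⟩
    have hzc : ContinuousOn z (Icc 0 t) := fun s hs =>
      (hder s (hsub hs)).continuousAt.continuousWithinAt
    have hconst : ∀ s ∈ Icc 0 t, H (z s) = H (z 0) := by
      refine constant_of_has_deriv_right_zero (hH.continuous.comp_continuousOn hzc) fun s hs => ?_
      have := (hH (z s)).hasFDerivAt.comp_hasDerivAt s (hder s (hsub (Ico_subset_Icc_self hs)))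
      rw [map_smul, hHF, smul_zero] at this
      exact this.hasDerivWithinAt
    have hgr := norm_le_gronwallBound_of_norm_deriv_right_le hzc
      (fun s hs => (hder s (hsub (Ico_subset_Icc_self hs))).hasDerivWithinAt)
      (δ := ‖z₀‖) (K := C) (ε := C) (by rw [hz0]) (fun s hs => ?_) t (right_mem_Icc.2 ht.1)
    · refine hgr.trans (le_max_of_le_left ?_)
      exact gronwallBound_mono (norm_nonneg _) hC0 hC0 (by linarith [ht.2])
    · rw [norm_smul, Real.norm_of_nonneg χ.nonneg]
      refine (mul_le_of_le_one_left (norm_nonneg _) χ.le_one).trans (hC _ ?_)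
      rw [hconst s (Ico_subset_Icc_self hs), hz0]
  refine ⟨z, hz0, fun t ht => ?_⟩
  have h1 : χ (z t) = 1 := χ.one_of_mem_closedBall (by simpa using hbound t ht)
  simpa [h1] using hder t ht

/-- If a `C¹` vector field has a conserved quantity on whose level sets it grows at most linearly,
then its integral curves exist for all forward times. -/
theorem ContDiff.exists_hasDerivAt_Ici_of_conserved {F : E → E} (hF : ContDiff ℝ 1 F) {H : E → ℝ}
    (hH : Differentiable ℝ H) (hHF : ∀ z, fderiv ℝ H z (F z) = 0)
    (hgrow : ∀ h, ∃ C, 0 ≤ C ∧ ∀ z, H z = h → ‖F z‖ ≤ C * ‖z‖ + C) (z₀ : E) :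
    ∃ z : ℝ → E, z 0 = z₀ ∧ ∀ t ∈ Ici 0, HasDerivAt z (F (z t)) t := by
  choose ζ hζ0 hζ using fun n : ℕ => hF.exists_hasDerivAt_Ico_of_conserved hH hHF hgrow z₀
    (T := n + 1) (by positivity)
  have hfloor : ∀ s : ℝ, s < ⌊s⌋₊ + 1 := Nat.lt_floor_add_one
  have hagree : ∀ (n : ℕ) (s : ℝ), 0 ≤ s → s < n + 1 → ζ ⌊s⌋₊ s = ζ n s := by
    intro n s hs hsn
    have hle : (⌊s⌋₊ : ℝ) ≤ n := by
      have : ⌊s⌋₊ < n + 1 := (Nat.floor_lt hs).2 (by exact_mod_cast hsn)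
      exact_mod_cast Nat.lt_succ_iff.1 this
    exact hF.eqOn_Ico_of_hasDerivAt ((hζ0 _).trans (hζ0 _).symm) (hζ _)
      (fun t ht => hζ n t ⟨ht.1, ht.2.trans_le (by linarith)⟩) ⟨hs, hfloor s⟩
  refine ⟨fun t => ζ ⌊t⌋₊ t, by simpa using hζ0 0, fun t ht => ?_⟩
  have hev : (fun s => ζ ⌊s⌋₊ s) =ᶠ[nhds t] ζ ⌊t⌋₊ := by
    filter_upwards [Iio_mem_nhds (hfloor t), Ioi_mem_nhds (show t - 1 < t by linarith)]
      with s hs hs'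
    rcases le_or_gt 0 s with h | h
    · exact hagree _ s h hs
    · have h1 : ⌊t⌋₊ = 0 := Nat.floor_eq_zero.2 (by simp only [mem_Ioi] at hs'; linarith)
      rw [h1, Nat.floor_of_nonpos h.le]
  exact (hζ ⌊t⌋₊ t ⟨ht, hfloor t⟩).congr_of_eventuallyEq hev

end ODE

section CosineKernel

theorem summable_of_summable_mul_one_add_sq {ι W : Type*} [NormedAddCommGroup W]
    {w : ι → ℝ} {κ : ι → W} (hw : ∀ k, 0 ≤ w k)
    (hsum : Summable fun k => w k * (1 + ‖κ k‖ ^ 2)) : Summable w :=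
  hsum.of_nonneg_of_le hw fun k => le_mul_of_one_le_right (hw k) (by nlinarith [sq_nonneg ‖κ k‖])

variable {ι A V : Type*} [Fintype A] [NormedAddCommGroup V] [InnerProductSpace ℝ V]

/-- The field `p ↦ ∑ₐ K(p - xₐ) mₐ` generated by sources `mₐ` at `xₐ` through a kernel `K`. -/
def kernelField (K : V → V →L[ℝ] V) (x m : A → V) (p : V) : V :=
  ∑ a, K (p - x a) (m a)

/-- The interaction energy `½ ∑ₐ ⟨mₐ, u(xₐ)⟩` of sources with the field `u` they generate. -/
def kernelEnergy (K : V → V →L[ℝ] V) (x m : A → V) : ℝ :=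
  2⁻¹ * ∑ a, inner ℝ (m a) (kernelField K x m (x a))

section Kernel

variable {K : V → V →L[ℝ] V}

theorem hasFDerivAt_kernelField (hK : Differentiable ℝ K) (x m : A → V) (p : V) :
    HasFDerivAt (kernelField K x m) (∑ a, (fderiv ℝ K (p - x a)).flip (m a)) p := by
  unfold kernelField
  refine HasFDerivAt.fun_sum fun a _ => ?_
  have h := (hK (p - x a)).hasFDerivAt.comp p ((hasFDerivAt_id p).sub_const (x a))
  have h2 := h.clm_apply (hasFDerivAt_const (m a) p)
  refine h2.congr_fderiv ?_
  ext v
  simp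

theorem fderiv_kernelField_apply (hK : Differentiable ℝ K) (x m : A → V) (p v : V) :
    fderiv ℝ (kernelField K x m) p v = ∑ a, fderiv ℝ K (p - x a) v (m a) := by
  simp [(hasFDerivAt_kernelField hK x m p).fderiv]

theorem contDiff_kernelField {n : WithTop ℕ∞} (hK : ContDiff ℝ n K) (b : A) :
    ContDiff ℝ n fun z : (A → V) × (A → V) => kernelField K z.1 z.2 (z.1 b) := by
  unfold kernelField
  fun_prop

theorem contDiff_fderiv_kernelField_apply (hK : ContDiff ℝ 2 K) (b : A) (v : V) :
    ContDiff ℝ 1 fun z : (A → V) × (A → V) => fderiv ℝ (kernelField K z.1 z.2) (z.1 b) v := by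
  simp_rw [fderiv_kernelField_apply (hK.differentiable two_ne_zero)]
  have h1 : ContDiff ℝ 1 (fderiv ℝ K) := hK.fderiv_right (by norm_num)
  fun_prop

theorem contDiff_kernelEnergy {n : WithTop ℕ∞} (hK : ContDiff ℝ n K) :
    ContDiff ℝ n fun z : (A → V) × (A → V) => kernelEnergy K z.1 z.2 := by
  unfold kernelEnergy
  refine contDiff_const.mul (ContDiff.sum fun a _ => ?_)
  exact ContDiff.inner ℝ (by fun_prop) (contDiff_kernelField hK a)

/-- The derivative of the energy along a moving configuration, for an even kernel with symmetric
values. -/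
theorem hasDerivAt_kernelEnergy (hK : Differentiable ℝ K) (heven : ∀ z, K (-z) = K z)
    (hsymm : ∀ z u v, inner ℝ (K z u) v = inner ℝ u (K z v)) {x m : A → ℝ → V} {x' m' : A → V}
    {t : ℝ} (hx : ∀ a, HasDerivAt (x a) (x' a) t) (hm : ∀ a, HasDerivAt (m a) (m' a) t) :
    HasDerivAt (fun s => kernelEnergy K (fun a => x a s) (fun a => m a s))
      (∑ a, (inner ℝ (m' a) (kernelField K (fun b => x b t) (fun b => m b t) (x a t)) +
        inner ℝ (m a t) (fderiv ℝ (kernelField K (fun b => x b t) (fun b => m b t)) (x a t)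
          (x' a)))) t := by
  have hodd : ∀ z v, fderiv ℝ K (-z) v = -fderiv ℝ K z v := by
    intro z v
    have h := (hK (-z)).hasFDerivAt.comp z (hasFDerivAt_id z).neg
    have h2 : K ∘ Neg.neg = K := by ext1 y; simp [heven]
    rw [h2] at h
    rw [h.fderiv]
    simp
  have hsymm' : ∀ z v a b, inner ℝ (fderiv ℝ K z v a) b = inner ℝ a (fderiv ℝ K z v b) := by
    intro z v a b
    have h1 := ((hK z).hasFDerivAt.clm_apply (hasFDerivAt_const a z)).inner ℝ
      (hasFDerivAt_const b z)
    have h2 := (hasFDerivAt_const a z).inner ℝ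
      ((hK z).hasFDerivAt.clm_apply (hasFDerivAt_const b z))
    simp_rw [hsymm] at h1
    have := congrArg (fun L => L v) (h1.unique h2)
    simpa using this
  have hterm : ∀ a b, HasDerivAt (fun s => inner ℝ (m a s) (K (x a s - x b s) (m b s)))
      (inner ℝ (m' a) (K (x a t - x b t) (m b t)) + inner ℝ (m' b) (K (x b t - x a t) (m a t)) +
        (inner ℝ (m a t) (fderiv ℝ K (x a t - x b t) (x' a) (m b t)) +
          inner ℝ (m b t) (fderiv ℝ K (x b t - x a t) (x' b) (m a t)))) t := by
    intro a b
    have h1 := (hK (x a t - x b t)).hasFDerivAt.comp_hasDerivAt t ((hx a).sub (hx b))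
    have h2 := (hm a).inner ℝ (h1.clm_apply (hm b))
    refine h2.congr_deriv ?_
    have e1 : inner ℝ (m' b) (K (x b t - x a t) (m a t)) =
        inner ℝ (m a t) (K (x a t - x b t) (m' b)) := by
      rw [← neg_sub, heven, ← hsymm, real_inner_comm]
    have e2 : inner ℝ (m b t) (fderiv ℝ K (x b t - x a t) (x' b) (m a t)) =
        -inner ℝ (m a t) (fderiv ℝ K (x a t - x b t) (x' b) (m b t)) := by
      rw [← neg_sub, hodd, neg_apply, inner_neg_right, ← hsymm',
        real_inner_comm]
    rw [e1, e2]
    simp [inner_add_right, inner_sub_right]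
    ring
  have hsum := (HasDerivAt.fun_sum (u := Finset.univ) fun a _ =>
    HasDerivAt.fun_sum (u := Finset.univ) fun b _ => hterm a b).const_mul (2⁻¹ : ℝ)
  unfold kernelEnergy kernelField
  simp only [inner_sum]
  refine hsum.congr_deriv ?_
  have := fun a => fderiv_kernelField_apply hK (fun b => x b t) (fun b => m b t) (x a t) (x' a)
  unfold kernelField at this
  simp only [this, inner_sum, Finset.sum_add_distrib]
  rw [Finset.sum_comm (f := fun a b => inner ℝ (m' b) (K (x b t - x a t) (m a t))),
    Finset.sum_comm (f := fun a b => inner ℝ (m b t) (fderiv ℝ K (x b t - x a t) (x' b) (m a t)))]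
  ring

end Kernel

theorem norm_iteratedFDeriv_cos_inner_le (v z : V) (n : ℕ) :
    ‖iteratedFDeriv ℝ n (fun y => cos (inner ℝ v y)) z‖ ≤ ‖v‖ ^ n := by
  have h := (innerSL ℝ v).iteratedFDeriv_comp_right (f := cos) (n := n) contDiff_cos z
    (i := n) le_rfl
  have h' : (fun y => cos (inner ℝ v y)) = cos ∘ innerSL ℝ v := rfl
  rw [h', h]
  refine (ContinuousMultilinearMap.norm_compContinuousLinearMap_le _ _).trans ?_
  rw [Finset.prod_const, Finset.card_fin, innerSL_apply_norm,
    norm_iteratedFDeriv_eq_norm_iteratedDeriv]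
  exact mul_le_of_le_one_left (by positivity) (abs_iteratedDeriv_cos_le_one n _)

theorem HasSum.clm_apply_const {f : ι → V →L[ℝ] V} {L : V →L[ℝ] V} (h : HasSum f L) (u : V) :
    HasSum (fun k => f k u) (L u) :=
  h.mapL (ContinuousLinearMap.apply ℝ V u)

theorem hasFDerivAt_cos_inner_smul (c : ℝ) (v z : V) (P : V →L[ℝ] V) :
    HasFDerivAt (fun y => (c * cos (inner ℝ v y)) • P)
      (((-(c * sin (inner ℝ v z))) • innerSL ℝ v).smulRight P) z := by
  have h := (((innerSL ℝ v).hasFDerivAt (x := z)).cos.const_mul c).smul_const P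
  refine h.congr_fderiv ?_
  congr 1
  ext u
  simp [mul_assoc]

variable [FiniteDimensional ℝ V]

theorem norm_sq_starProjection (U : Submodule ℝ V) (v : V) :
    ‖U.starProjection v‖ ^ 2 = inner ℝ v (U.starProjection v) := by
  rw [← real_inner_self_eq_norm_sq, Submodule.inner_starProjection_left_eq_right,
    Submodule.starProjection_eq_self_iff.2 (Submodule.starProjection_apply_mem _ _)]

/-- The operator-valued cosine series `∑ₖ wₖ cos⟨κₖ, z⟩ Pₖ`, where `Pₖ` is the orthogonal
projection onto `Sₖ`. -/
def cosKernel (w : ι → ℝ) (κ : ι → V) (S : ι → Submodule ℝ V) (z : V) : V →L[ℝ] V :=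
  ∑' k, (w k * cos (inner ℝ (κ k) z)) • (S k).starProjection

variable {w : ι → ℝ} {κ : ι → V} {S : ι → Submodule ℝ V}

theorem norm_smul_starProjection_le (c : ℝ) (U : Submodule ℝ V) :
    ‖c • U.starProjection‖ ≤ |c| := by
  rw [norm_smul, Real.norm_eq_abs]
  exact mul_le_of_le_one_right (abs_nonneg _) U.starProjection_norm_le

theorem contDiff_cosKernel (hw : ∀ k, 0 ≤ w k)
    (hsum : Summable fun k => w k * (1 + ‖κ k‖ ^ 2)) : ContDiff ℝ 2 (cosKernel w κ S) := by
  have key : ContDiff ℝ ((2 : ℕ∞) : WithTop ℕ∞) fun z : V =>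
      ∑' k, (w k * cos (inner ℝ (κ k) z)) • (S k).starProjection := by
    refine contDiff_tsum (v := fun _ k => w k * (1 + ‖κ k‖ ^ 2)) (fun k => ?_)
      (fun _ _ => hsum) (fun n k z hn => ?_)
    · exact ((contDiff_const.mul (innerSL ℝ (κ k)).contDiff.cos).smul contDiff_const)
    · have hn2 : n ≤ 2 := by exact_mod_cast hn
      have hc : ContDiff ℝ n fun y => cos (inner ℝ (κ k) y) :=
        (innerSL ℝ (κ k)).contDiff.cos
      have e : (fun z => (w k * cos (inner ℝ (κ k) z)) • (S k).starProjection) =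
          ((w k • ContinuousLinearMap.id ℝ ℝ).smulRight (S k).starProjection) ∘
            fun y => cos (inner ℝ (κ k) y) := by
        ext1 y; simp [mul_smul]
      rw [e]
      refine (ContinuousLinearMap.norm_iteratedFDeriv_comp_left _ hc.contDiffAt le_rfl).trans ?_
      gcongr
      · exact hw k
      · rw [ContinuousLinearMap.norm_smulRight_apply, norm_smul, ContinuousLinearMap.norm_id,
          Real.norm_of_nonneg (hw k), mul_one]
        exact mul_le_of_le_one_right (hw k) (S k).starProjection_norm_le
      · refine (norm_iteratedFDeriv_cos_inner_le _ _ _).trans ?_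
        interval_cases n
        · simp
        · nlinarith [sq_nonneg (‖κ k‖ - 1), norm_nonneg (κ k)]
        · linarith
  exact key

theorem norm_cos_inner_smul_deriv_le {c : ℝ} (hc : 0 ≤ c) (v z : V) (U : Submodule ℝ V) :
    ‖((-(c * sin (inner ℝ v z))) • innerSL ℝ v).smulRight U.starProjection‖ ≤
      c * (1 + ‖v‖ ^ 2) := by
  rw [ContinuousLinearMap.norm_smulRight_apply, norm_smul, norm_neg, norm_mul,
    Real.norm_of_nonneg hc, innerSL_apply_norm, mul_assoc, mul_assoc]
  refine mul_le_mul_of_nonneg_left ?_ hc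
  calc _ ≤ 1 * (‖v‖ * 1) := by
        gcongr
        · exact abs_sin_le_one _
        · exact U.starProjection_norm_le
    _ ≤ _ := by nlinarith [sq_nonneg (‖v‖ - 1), norm_nonneg v]

theorem hasSum_cosKernel (hw : ∀ k, 0 ≤ w k) (hws : Summable w) (z : V) :
    HasSum (fun k => (w k * cos (inner ℝ (κ k) z)) • (S k).starProjection)
      (cosKernel w κ S z) := by
  refine (Summable.of_norm_bounded hws fun k => ?_).hasSum
  refine (norm_smul_starProjection_le _ _).trans ?_
  rw [abs_mul, abs_of_nonneg (hw k)]
  exact mul_le_of_le_one_right (hw k) (abs_cos_le_one _)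

theorem hasSum_fderiv_cosKernel (hw : ∀ k, 0 ≤ w k)
    (hsum : Summable fun k => w k * (1 + ‖κ k‖ ^ 2)) (z v : V) :
    HasSum (fun k => (-(w k * sin (inner ℝ (κ k) z) * inner ℝ (κ k) v)) • (S k).starProjection)
      (fderiv ℝ (cosKernel w κ S) z v) := by
  have hK := hasFDerivAt_tsum hsum
    (fun k z => hasFDerivAt_cos_inner_smul (w k) (κ k) z (S k).starProjection)
    (fun k z => norm_cos_inner_smul_deriv_le (hw k) (κ k) z (S k))
    (hasSum_cosKernel hw (summable_of_summable_mul_one_add_sq hw hsum) 0).summable z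
  have hS := (Summable.of_norm_bounded (E := V →L[ℝ] V →L[ℝ] V) hsum
    fun k => norm_cos_inner_smul_deriv_le (hw k) (κ k) z (S k)).hasSum
  rw [← hK.fderiv] at hS
  refine (hS.mapL (ContinuousLinearMap.apply ℝ (V →L[ℝ] V) v)).congr_fun fun k => ?_
  simp

theorem cosKernel_neg (z : V) : cosKernel w κ S (-z) = cosKernel w κ S z := by
  simp [cosKernel]

theorem inner_cosKernel_left (hw : ∀ k, 0 ≤ w k) (hws : Summable w) (z u v : V) :
    inner ℝ (cosKernel w κ S z u) v = inner ℝ u (cosKernel w κ S z v) := by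
  have h1 := ((hasSum_cosKernel (κ := κ) (S := S) hw hws z).clm_apply_const u).mapL (innerSL ℝ v)
  have h2 := ((hasSum_cosKernel (κ := κ) (S := S) hw hws z).clm_apply_const v).mapL (innerSL ℝ u)
  simp only [innerSL_apply_apply] at h1 h2
  rw [real_inner_comm]
  refine h1.unique (h2.congr_fun fun k => Eq.symm ?_)
  simp only [smul_apply, inner_smul_right]
  rw [← Submodule.inner_starProjection_left_eq_right, real_inner_comm (x := v)]

/-- The projected cosine mode of a configuration. -/
def cosMode (κ : V) (U : Submodule ℝ V) (x m : A → V) : V :=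
  U.starProjection (∑ a, cos (inner ℝ κ (x a)) • m a)

/-- The projected sine mode of a configuration. -/
def sinMode (κ : V) (U : Submodule ℝ V) (x m : A → V) : V :=
  U.starProjection (∑ a, sin (inner ℝ κ (x a)) • m a)

theorem hasSum_kernelField (hw : ∀ k, 0 ≤ w k) (hws : Summable w) (x m : A → V) (p : V) :
    HasSum (fun k => w k • (cos (inner ℝ (κ k) p) • cosMode (κ k) (S k) x m +
      sin (inner ℝ (κ k) p) • sinMode (κ k) (S k) x m))
      (kernelField (cosKernel w κ S) x m p) := by
  have h := hasSum_sum (s := Finset.univ) fun a _ =>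
    (hasSum_cosKernel (κ := κ) (S := S) hw hws (p - x a)).clm_apply_const (m a)
  refine h.congr_fun fun k => Eq.symm ?_
  simp only [cosMode, sinMode, map_sum, map_smul, inner_sub_right, cos_sub, smul_apply,
    Finset.smul_sum, ← Finset.sum_add_distrib]
  refine Finset.sum_congr rfl fun a _ => ?_
  module

theorem hasSum_fderiv_kernelField (hw : ∀ k, 0 ≤ w k)
    (hsum : Summable fun k => w k * (1 + ‖κ k‖ ^ 2)) (x m : A → V) (p v : V) :
    HasSum (fun k => (w k * inner ℝ (κ k) v) • (cos (inner ℝ (κ k) p) • sinMode (κ k) (S k) x m -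
      sin (inner ℝ (κ k) p) • cosMode (κ k) (S k) x m))
      (fderiv ℝ (kernelField (cosKernel w κ S) x m) p v) := by
  rw [fderiv_kernelField_apply ((contDiff_cosKernel hw hsum).differentiable two_ne_zero)]
  have h := hasSum_sum (s := Finset.univ) fun a _ =>
    (hasSum_fderiv_cosKernel (κ := κ) (S := S) hw hsum (p - x a) v).clm_apply_const (m a)
  refine h.congr_fun fun k => Eq.symm ?_
  simp only [cosMode, sinMode, map_sum, map_smul, inner_sub_right, sin_sub, smul_apply,
    Finset.smul_sum, ← Finset.sum_sub_distrib]
  refine Finset.sum_congr rfl fun a _ => ?_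
  module

theorem hasSum_kernelEnergy (hw : ∀ k, 0 ≤ w k) (hws : Summable w) (x m : A → V) :
    HasSum (fun k => w k * (2⁻¹ * (‖cosMode (κ k) (S k) x m‖ ^ 2 +
      ‖sinMode (κ k) (S k) x m‖ ^ 2))) (kernelEnergy (cosKernel w κ S) x m) := by
  have h := (hasSum_sum (s := Finset.univ) fun a _ =>
    (hasSum_kernelField (κ := κ) (S := S) hw hws x m (x a)).mapL (innerSL ℝ (m a))).mul_left 2⁻¹
  refine h.congr_fun fun k => Eq.symm ?_
  have hc : ‖cosMode (κ k) (S k) x m‖ ^ 2 =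
      ∑ a, cos (inner ℝ (κ k) (x a)) * inner ℝ (m a) (cosMode (κ k) (S k) x m) := by
    rw [cosMode, norm_sq_starProjection, sum_inner]
    simp only [real_inner_smul_left]
  have hs : ‖sinMode (κ k) (S k) x m‖ ^ 2 =
      ∑ a, sin (inner ℝ (κ k) (x a)) * inner ℝ (m a) (sinMode (κ k) (S k) x m) := by
    rw [sinMode, norm_sq_starProjection, sum_inner]
    simp only [real_inner_smul_left]
  rw [hc, hs, ← Finset.sum_add_distrib]
  simp only [innerSL_apply_apply, real_inner_smul_right, inner_add_right, Finset.mul_sum]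
  exact Finset.sum_congr rfl fun i _ => by ring

theorem norm_kernelField_le (hw : ∀ k, 0 ≤ w k)
    (hsum : Summable fun k => w k * (1 + ‖κ k‖ ^ 2)) (x m : A → V) (p : V) :
    ‖kernelField (cosKernel w κ S) x m p‖ ≤
      (∑' k, w k * (1 + ‖κ k‖ ^ 2)) + kernelEnergy (cosKernel w κ S) x m := by
  have hws := summable_of_summable_mul_one_add_sq hw hsum
  refine (hasSum_kernelField hw hws x m p).norm_le_of_bounded
    (hsum.hasSum.add (hasSum_kernelEnergy hw hws x m)) fun k => ?_
  rw [← mul_add, norm_smul, Real.norm_of_nonneg (hw k)]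
  refine mul_le_mul_of_nonneg_left ?_ (hw k)
  refine (norm_add_le _ _).trans ?_
  rw [norm_smul, norm_smul]
  have h1 := mul_le_of_le_one_left (norm_nonneg (cosMode (κ k) (S k) x m))
    (abs_cos_le_one (inner ℝ (κ k) p))
  have h2 := mul_le_of_le_one_left (norm_nonneg (sinMode (κ k) (S k) x m))
    (abs_sin_le_one (inner ℝ (κ k) p))
  simp only [Real.norm_eq_abs]
  nlinarith [sq_nonneg (‖cosMode (κ k) (S k) x m‖ - 1), sq_nonneg (‖sinMode (κ k) (S k) x m‖ - 1),
    sq_nonneg ‖κ k‖]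

theorem norm_fderiv_kernelField_le (hw : ∀ k, 0 ≤ w k)
    (hsum : Summable fun k => w k * (1 + ‖κ k‖ ^ 2)) (x m : A → V) (p : V) :
    ‖fderiv ℝ (kernelField (cosKernel w κ S) x m) p‖ ≤
      (∑' k, w k * (1 + ‖κ k‖ ^ 2)) + kernelEnergy (cosKernel w κ S) x m := by
  have hws := summable_of_summable_mul_one_add_sq hw hsum
  have hH := hsum.hasSum.add (hasSum_kernelEnergy (κ := κ) (S := S) hw hws x m)
  refine ContinuousLinearMap.opNorm_le_bound _ (hH.nonneg fun k => ?_) fun v => ?_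
  · have := hw k
    positivity
  refine (hasSum_fderiv_kernelField hw hsum x m p v).norm_le_of_bounded
    (hH.mul_right ‖v‖) fun k => ?_
  rw [← mul_add, norm_smul, norm_mul, Real.norm_of_nonneg (hw k), mul_assoc, mul_assoc]
  refine mul_le_mul_of_nonneg_left ?_ (hw k)
  have h0 : ‖cos (inner ℝ (κ k) p) • sinMode (κ k) (S k) x m -
      sin (inner ℝ (κ k) p) • cosMode (κ k) (S k) x m‖ ≤
      ‖cosMode (κ k) (S k) x m‖ + ‖sinMode (κ k) (S k) x m‖ := by
    refine (norm_sub_le _ _).trans ?_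
    rw [norm_smul, norm_smul, add_comm]
    exact add_le_add (mul_le_of_le_one_left (norm_nonneg _) (abs_sin_le_one _))
      (mul_le_of_le_one_left (norm_nonneg _) (abs_cos_le_one _))
  calc _ ≤ (‖κ k‖ * ‖v‖) * (‖cosMode (κ k) (S k) x m‖ + ‖sinMode (κ k) (S k) x m‖) := by
        gcongr
        exact norm_inner_le_norm _ _
    _ = (‖κ k‖ * (‖cosMode (κ k) (S k) x m‖ + ‖sinMode (κ k) (S k) x m‖)) * ‖v‖ := by ring
    _ ≤ _ := by
        gcongr
        nlinarith [sq_nonneg (‖cosMode (κ k) (S k) x m‖ - ‖κ k‖),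
          sq_nonneg (‖sinMode (κ k) (S k) x m‖ - ‖κ k‖)]

end CosineKernel


section LoopSystem

/-- The coordinatewise real part. -/
def reC3 : C3 →L[ℝ] E3 where
  toFun v := WithLp.toLp 2 fun i => (v i).re
  map_add' u v := by ext i; simp
  map_smul' c v := by ext i; simp
  cont := by fun_prop

@[simp]
theorem reC3_apply (v : C3) (i : Fin 3) : reC3 v i = (v i).re := rfl

/-- The Fourier weights of the velocity field. -/
def loopWeight (ρh : (Fin 3 → ℤ) → ℝ) (k : Fin 3 → ℤ) : ℝ := ((2 * π) ^ 3)⁻¹ * ρh k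

/-- The interaction kernel of the loop system. -/
def loopKernel (ρh : (Fin 3 → ℤ) → ℝ) : E3 → E3 →L[ℝ] E3 :=
  cosKernel (loopWeight ρh) kR fun k => (Submodule.span ℝ {kR k})ᗮ

theorem norm_kC (k : Fin 3 → ℤ) : ‖kC k‖ = ‖kR k‖ := by
  simp [EuclideanSpace.norm_eq, kC, kR]

theorem norm_toC3 (m : E3) : ‖toC3 m‖ = ‖m‖ := by
  simp [EuclideanSpace.norm_eq, toC3]

theorem projPerp_eq_starProjection (k : Fin 3 → ℤ) (v : C3) :
    projPerp k v = (Submodule.span ℂ {kC k})ᗮ.starProjection v := by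
  rw [Submodule.starProjection_orthogonal_val, Submodule.starProjection_singleton, norm_kC,
    projPerp]
  split_ifs with hk
  · subst hk
    have : kC 0 = 0 := by ext i; simp [kC]
    simp [this]
  · rfl

theorem norm_projPerp_le (k : Fin 3 → ℤ) (v : C3) : ‖projPerp k v‖ ≤ ‖v‖ := by
  rw [projPerp_eq_starProjection]
  exact ((Submodule.span ℂ {kC k})ᗮ.starProjection.le_of_opNorm_le
    (Submodule.starProjection_norm_le _) v).trans (one_mul _).le

theorem reC3_projPerp (k : Fin 3 → ℤ) (v : C3) :
    reC3 (projPerp k v) = (Submodule.span ℝ {kR k})ᗮ.starProjection (reC3 v) := by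
  rw [projPerp_eq_starProjection, Submodule.starProjection_orthogonal_val,
    Submodule.starProjection_orthogonal_val, Submodule.starProjection_singleton,
    Submodule.starProjection_singleton, norm_kC, map_sub]
  congr 1
  have h : (inner ℂ (kC k) v).re = inner ℝ (kR k) (reC3 v) := by
    simp [PiLp.inner_apply, kC, kR, Fin.sum_univ_three]
  ext i
  have hre : ∀ (a : ℂ) (r : ℝ) (n : ℤ), (a / (r : ℂ) * (n : ℂ)).re = a.re / r * n := by
    intro a r n
    rw [← Complex.ofReal_intCast, Complex.re_mul_ofReal, Complex.div_ofReal_re]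
  have := hre (inner ℂ (kC k) v) (‖kR k‖ ^ 2) (k i)
  rw [h] at this
  simpa [kC, kR] using this

theorem reC3_exp_smul_toC3 (s : ℝ) (m : E3) :
    reC3 (Complex.exp (-Complex.I * (s : ℂ)) • toC3 m) = cos s • m := by
  have h : (Complex.exp (-Complex.I * (s : ℂ))).re = cos s := by
    rw [show -Complex.I * (s : ℂ) = ((-s : ℝ) : ℂ) * Complex.I by push_cast; ring,
      Complex.exp_ofReal_mul_I_re, cos_neg]
  ext i
  simp only [reC3_apply, toC3, PiLp.smul_apply, smul_eq_mul, Complex.re_mul_ofReal, h]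

theorem loopWeight_nonneg {ρh : (Fin 3 → ℤ) → ℝ} (hnn : ∀ k, 0 ≤ ρh k) (k : Fin 3 → ℤ) :
    0 ≤ loopWeight ρh k :=
  mul_nonneg (by positivity) (hnn k)

theorem summable_loopWeight {ρh : (Fin 3 → ℤ) → ℝ} (hnn : ∀ k, 0 ≤ ρh k)
    (hsum : Summable fun k : Fin 3 → ℤ => (1 + ‖kR k‖ ^ 2) ^ 2 * ρh k) :
    Summable fun k => loopWeight ρh k * (1 + ‖kR k‖ ^ 2) := by
  refine (hsum.mul_left ((2 * π) ^ 3)⁻¹).of_nonneg_of_le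
    (fun k => mul_nonneg (loopWeight_nonneg hnn k) (by positivity)) fun k => ?_
  rw [loopWeight, mul_assoc, mul_comm (ρh k)]
  refine mul_le_mul_of_nonneg_left (mul_le_mul_of_nonneg_right ?_ (hnn k)) (by positivity)
  nlinarith [sq_nonneg ‖kR k‖]

theorem loopVel_eq_kernelField {N : ℕ} {ρh : (Fin 3 → ℤ) → ℝ} (hnn : ∀ k, 0 ≤ ρh k)
    (hρ : Summable ρh) (x m : Fin N → E3) :
    loopVel N ρh x m = kernelField (loopKernel ρh) x m := by
  ext1 p
  change reC3 (loopVelC N ρh x m p) = _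
  have hs : Summable fun k : Fin 3 → ℤ => (ρh k : ℂ) • projPerp k (∑ α,
      Complex.exp (-Complex.I * ((inner ℝ (kR k) (p - x α) : ℝ) : ℂ)) • toC3 (m α)) := by
    refine Summable.of_norm_bounded (hρ.mul_right (∑ α, ‖m α‖)) fun k => ?_
    rw [norm_smul, Complex.norm_real, Real.norm_of_nonneg (hnn k)]
    refine mul_le_mul_of_nonneg_left ((norm_projPerp_le _ _).trans ?_) (hnn k)
    refine norm_sum_le_of_le _ fun α _ => ?_
    rw [norm_smul, norm_toC3, show ∀ s : ℝ, -Complex.I * (s : ℂ) = ((-s : ℝ) : ℂ) * Complex.I by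
      intro s; push_cast; ring, Complex.norm_exp_ofReal_mul_I, one_mul]
  have h1 := (hs.hasSum.mapL reC3).const_smul (((2 * π : ℝ) ^ 3)⁻¹)
  have h2 := hasSum_sum (s := Finset.univ) fun α _ =>
    (hasSum_cosKernel (κ := kR) (S := fun k => (Submodule.span ℝ {kR k})ᗮ)
      (loopWeight_nonneg hnn) (hρ.mul_left _) (p - x α)).clm_apply_const (m α)
  rw [loopVelC, map_smul]
  refine h1.unique (h2.congr_fun fun k => ?_)
  have h3 : ∀ v : C3, reC3 ((ρh k : ℂ) • v) = ρh k • reC3 v := by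
    intro v
    ext i
    simp
  rw [h3, reC3_projPerp, map_sum, map_sum, Finset.smul_sum, Finset.smul_sum]
  refine Finset.sum_congr rfl fun α _ => ?_
  rw [reC3_exp_smul_toC3, map_smul, smul_apply, loopWeight, mul_smul, mul_smul]

theorem hasDerivAt_euclidean {n : Type*} [Fintype n] {f : ℝ → EuclideanSpace ℝ n}
    {f' : EuclideanSpace ℝ n} {t : ℝ} :
    HasDerivAt f f' t ↔ ∀ i, HasDerivAt (fun s => f s i) (f' i) t := by
  simp only [hasDerivAt_iff_hasFDerivAt, ← hasFDerivWithinAt_univ]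
  rw [hasFDerivWithinAt_euclidean]
  refine forall_congr' fun i => ?_
  rw [show PiLp.proj 2 (fun _ => ℝ) i ∘L ContinuousLinearMap.toSpanSingleton ℝ f' =
    ContinuousLinearMap.toSpanSingleton ℝ (f' i) by ext; simp]

/-- The vector field of the loop system with interaction kernel `K`. -/
def loopField {A : Type*} [Fintype A] (K : E3 → E3 →L[ℝ] E3) (z : (A → E3) × (A → E3)) :
    (A → E3) × (A → E3) :=
  (fun α => kernelField K z.1 z.2 (z.1 α), fun α => WithLp.toLp 2 fun i =>
    -∑ j, z.2 α j * fderiv ℝ (kernelField K z.1 z.2) (z.1 α) (EuclideanSpace.single i 1) j)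

theorem isLoopSystemSolution_iff {N : ℕ} {ρh : (Fin 3 → ℤ) → ℝ} (hnn : ∀ k, 0 ≤ ρh k)
    (hρ : Summable ρh) (x m : Fin N → ℝ → E3) (T : Set ℝ) :
    IsLoopSystemSolution N ρh x m T ↔ ∀ t ∈ T,
      HasDerivAt (fun s => ((fun α => x α s, fun α => m α s) : (Fin N → E3) × (Fin N → E3)))
        (loopField (loopKernel ρh) (fun α => x α t, fun α => m α t)) t := by
  refine forall₂_congr fun t _ => ?_
  have hprod : ∀ {f g : ℝ → Fin N → E3} {f' g' : Fin N → E3},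
      HasDerivAt (fun s => (f s, g s)) (f', g') t ↔ HasDerivAt f f' t ∧ HasDerivAt g g' t :=
    fun {f g f' g'} => ⟨fun h => ⟨h.fst, h.snd⟩, fun h => h.1.prodMk h.2⟩
  rw [loopField, hprod, hasDerivAt_pi, hasDerivAt_pi, ← forall_and]
  refine forall_congr' fun α => ?_
  rw [hasDerivAt_euclidean (f := m α), loopVel_eq_kernelField hnn hρ]

theorem loopField_snd_eq_adjoint {A : Type*} [Fintype A] (K : E3 → E3 →L[ℝ] E3)
    (z : (A → E3) × (A → E3)) (α : A) :
    (loopField K z).2 α =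
      -(fderiv ℝ (kernelField K z.1 z.2) (z.1 α)).adjoint (z.2 α) := by
  ext i
  have h := EuclideanSpace.inner_single_left (𝕜 := ℝ) i 1
    ((fderiv ℝ (kernelField K z.1 z.2) (z.1 α)).adjoint (z.2 α))
  rw [ContinuousLinearMap.adjoint_inner_right] at h
  simp only [map_one, one_mul] at h
  rw [PiLp.neg_apply, ← h, PiLp.inner_apply]
  simp [loopField]

theorem contDiff_loopField {A : Type*} [Fintype A] {K : E3 → E3 →L[ℝ] E3} (hK : ContDiff ℝ 2 K) :
    ContDiff ℝ 1 (loopField (A := A) K) := by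
  refine ContDiff.prodMk (contDiff_pi.2 fun α => contDiff_kernelField (hK.of_le (by norm_num)) α)
    (contDiff_pi.2 fun α => contDiff_euclidean.2 fun i => ?_)
  refine (ContDiff.sum fun j _ => ContDiff.mul ?_ ?_).neg
  · exact contDiff_euclidean.1 (by fun_prop : ContDiff ℝ 1
      fun z : (A → E3) × (A → E3) => z.2 α) j
  · exact contDiff_euclidean.1 (contDiff_fderiv_kernelField_apply hK α _) j

/-- The energy is conserved by the loop system. -/
theorem fderiv_kernelEnergy_loopField {A : Type*} [Fintype A] {K : E3 → E3 →L[ℝ] E3}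
    (hK : ContDiff ℝ 2 K) (heven : ∀ z, K (-z) = K z)
    (hsymm : ∀ z u v, inner ℝ (K z u) v = inner ℝ u (K z v)) (z : (A → E3) × (A → E3)) :
    fderiv ℝ (fun z : (A → E3) × (A → E3) => kernelEnergy K z.1 z.2) z (loopField K z) = 0 := by
  have hline : ∀ u v : E3, HasDerivAt (fun s : ℝ => u + s • v) v 0 := fun u v => by
    simpa using ((hasDerivAt_id (0 : ℝ)).smul_const v).const_add u
  have h1 := hasDerivAt_kernelEnergy (hK.differentiable two_ne_zero) heven hsymm
    (fun a => hline (z.1 a) ((loopField K z).1 a)) (fun a => hline (z.2 a) ((loopField K z).2 a))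
  have hz : HasDerivAt (fun s : ℝ => z + s • loopField K z) (loopField K z) 0 := by
    simpa using ((hasDerivAt_id (0 : ℝ)).smul_const (loopField K z)).const_add z
  have h2 := HasFDerivAt.comp_hasDerivAt_of_eq (0 : ℝ)
    ((contDiff_kernelEnergy (A := A) hK).differentiable two_ne_zero z).hasFDerivAt hz (by simp)
  rw [h2.unique h1]
  refine Finset.sum_eq_zero fun a _ => ?_
  simp only [zero_smul, add_zero, loopField_snd_eq_adjoint, inner_neg_left,
    ContinuousLinearMap.adjoint_inner_left]
  simp [loopField]

theorem norm_loopField_le {ι A : Type*} [Fintype A] {w : ι → ℝ} {κ : ι → E3}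
    {S : ι → Submodule ℝ E3} (hw : ∀ k, 0 ≤ w k)
    (hsum : Summable fun k => w k * (1 + ‖κ k‖ ^ 2)) (z : (A → E3) × (A → E3)) {C : ℝ}
    (hC0 : 0 ≤ C)
    (hC : (∑' k, w k * (1 + ‖κ k‖ ^ 2)) + kernelEnergy (cosKernel w κ S) z.1 z.2 ≤ C) :
    ‖loopField (cosKernel w κ S) z‖ ≤ C * ‖z‖ + C := by
  have hz := mul_nonneg hC0 (norm_nonneg z)
  refine norm_prod_le_iff.2 ⟨(pi_norm_le_iff_of_nonneg (by positivity)).2 fun α => ?_,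
    (pi_norm_le_iff_of_nonneg (by positivity)).2 fun α => ?_⟩
  · exact ((norm_kernelField_le hw hsum z.1 z.2 _).trans hC).trans (by linarith)
  · rw [loopField_snd_eq_adjoint, norm_neg]
    have hD : ‖(fderiv ℝ (kernelField (cosKernel w κ S) z.1 z.2) (z.1 α)).adjoint‖ ≤ C := by
      rw [LinearIsometryEquiv.norm_map]
      exact (norm_fderiv_kernelField_le hw hsum z.1 z.2 (z.1 α)).trans hC
    have h1 := ContinuousLinearMap.le_of_opNorm_le _ hD (z.2 α)
    have h2 : ‖z.2 α‖ ≤ ‖z‖ := (norm_le_pi_norm z.2 α).trans (norm_snd_le z)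
    linarith [mul_le_mul_of_nonneg_left h2 hC0]

end LoopSystem

/-- Global existence and uniqueness for the periodic vortex loop system: for every
initial configuration there is a unique solution defined for all `t ∈ [0,∞)`. -/
theorem loop_global_existence_uniqueness (N : ℕ) (hN : 0 < N)
    (ρh : (Fin 3 → ℤ) → ℝ)
    (hnn : ∀ k, 0 ≤ ρh k) (hsym : ∀ k, ρh (-k) = ρh k)
    (hsum : Summable (fun k : Fin 3 → ℤ => (1 + ‖kR k‖ ^ 2) ^ 2 * ρh k))
    (x₀ m₀ : Fin N → E3) :
    ∃ x m : Fin N → ℝ → E3,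
      (∀ α, x α 0 = x₀ α ∧ m α 0 = m₀ α) ∧
      IsLoopSystemSolution N ρh x m (Ici 0) ∧
      ∀ x' m' : Fin N → ℝ → E3,
        (∀ α, x' α 0 = x₀ α ∧ m' α 0 = m₀ α) →
        IsLoopSystemSolution N ρh x' m' (Ici 0) →
        ∀ t : ℝ, 0 ≤ t → ∀ α, x' α t = x α t ∧ m' α t = m α t := by
  have hsum' := summable_loopWeight hnn hsum
  have hρ : Summable ρh := by
    refine hsum.of_nonneg_of_le hnn fun k => le_mul_of_one_le_left (hnn k) ?_
    nlinarith [sq_nonneg ‖kR k‖]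
  have hw := loopWeight_nonneg hnn
  have hws := summable_of_summable_mul_one_add_sq hw hsum'
  have hK : ContDiff ℝ 2 (loopKernel ρh) := contDiff_cosKernel hw hsum'
  have hF := contDiff_loopField (A := Fin N) hK
  obtain ⟨z, hz0, hz⟩ := hF.exists_hasDerivAt_Ici_of_conserved
    ((contDiff_kernelEnergy hK).differentiable two_ne_zero)
    (fderiv_kernelEnergy_loopField hK cosKernel_neg (inner_cosKernel_left hw hws))
    (fun h => ⟨|(∑' k, loopWeight ρh k * (1 + ‖kR k‖ ^ 2)) + h|, abs_nonneg _, fun y hy =>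
      norm_loopField_le hw hsum' y (abs_nonneg _) (hy ▸ le_abs_self _)⟩) (x₀, m₀)
  refine ⟨fun α t => (z t).1 α, fun α t => (z t).2 α, fun α => by simp [hz0],
    (isLoopSystemSolution_iff hnn hρ _ _ _).2 hz, fun x' m' h0 hsol t ht α => ?_⟩
  have heq := hF.eqOn_Ico_of_hasDerivAt (T := t + 1)
    (y := fun s => (fun α => x' α s, fun α => m' α s)) (z := z)
    (by rw [hz0]; exact Prod.ext (funext fun α => (h0 α).1) (funext fun α => (h0 α).2))
    (fun s hs => (isLoopSystemSolution_iff hnn hρ _ _ _).1 hsol s hs.1)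
    (fun s hs => hz s hs.1) ⟨ht, lt_add_one t⟩
  exact ⟨congrFun (congrArg Prod.fst heq) α, congrFun (congrArg Prod.snd heq) α⟩
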